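/- Let u, v, r ∈ R such that ug + vs = r, and let h ∈ R be such that hu = κ, hv = λ and hr = ω, where κ is given by the key equation ω = κg + λs. Let T = {l : 0 ≤ l ≤ n−1 and (x − α_l) |_r v} and m = |T|. Then m = deg v if and only if deg h = 0. -/

import Mathlib

/-- `δ` is a `σ`-derivation of the field `L`. -/
def IsSigmaDerivation {L : Type*} [Field L] (σ : L ≃+* L) (δ : L → L) : Prop :=
  (∀ a b : L, δ (a + b) = δ a + δ b) ∧ ∀ a b : L, δ (a * b) = σ a * δ b + δ a * b

/-- The ring `R`, together with the embedding of constants `C : L →+* R` and the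
element `X`, is the Ore extension `L[x;σ,δ]`: the twisting rule
`X * C a = C (σ a) * X + C (δ a)` holds and every element of `R` is, in a unique way,
a left `L`-linear combination of the powers of `X`. -/
structure IsOreExtension {L : Type*} [Field L] (σ : L ≃+* L) (δ : L → L)
    (R : Type*) [Ring R] (C : L →+* R) (X : R) : Prop where
  twist : ∀ a : L, X * C a = C (σ a) * X + C (δ a)
  repr_unique : ∀ r : R, ∃! f : ℕ →₀ L, r = f.sum fun n a => C a * X ^ n

/-- The degree of an Ore polynomial (`⊥` for the zero polynomial). -/
noncomputable def IsOreExtension.deg {L : Type*} [Field L] {σ : L ≃+* L} {δ : L → L}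
    {R : Type*} [Ring R] {C : L →+* R} {X : R}
    (H : IsOreExtension σ δ R C X) (r : R) : WithBot ℕ :=
  (H.repr_unique r).exists.choose.support.max

/-- `f` is a right divisor of `g` : `g = u * f` for some `u`. -/
def RDvd {R : Type*} [Ring R] (f g : R) : Prop := ∃ u, g = u * f

/-- `f` is a left divisor of `g` : `g = f * u` for some `u`. -/
def LDvd {R : Type*} [Ring R] (f g : R) : Prop := ∃ u, g = f * u

/-- `m` is a least common left multiple of the family `f`. -/
def IsLclm {R : Type*} [Ring R] {ι : Type*} (f : ι → R) (m : R) : Prop :=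
  (∀ i, RDvd (f i) m) ∧ ∀ m' : R, (∀ i, RDvd (f i) m') → RDvd m m'

/-- `m` is a least common right multiple of the family `f`. -/
def IsLcrm {R : Type*} [Ring R] {ι : Type*} (f : ι → R) (m : R) : Prop :=
  (∀ i, LDvd (f i) m) ∧ ∀ m' : R, (∀ i, LDvd (f i) m') → LDvd m m'

/-- `gcld (f, g) = 1`, i.e. `fR + gR = R`. -/
def LCoprime {R : Type*} [Ring R] (f g : R) : Prop := ∃ a b : R, f * a + g * b = 1

/-- `gcrd (f, g) = 1`, i.e. `Rf + Rg = R`. -/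
def RCoprime {R : Type*} [Ring R] (f g : R) : Prop := ∃ a b : R, a * f + b * g = 1

namespace IsOreExtension

/-- The polynomials of degree less than `d`. -/
def lowerTerms {L : Type*} [Field L] {R : Type*} [Ring R] (C : L →+* R) (X : R) (d : ℕ) :
    AddSubgroup R :=
  AddSubgroup.closure {r | ∃ a i, i < d ∧ r = C a * X ^ i}

section LowerTerms

variable {L : Type*} [Field L] {R : Type*} [Ring R] {C : L →+* R} {X : R}

lemma monomial_mem_lowerTerms (a : L) {i d : ℕ} (h : i < d) :
    C a * X ^ i ∈ lowerTerms C X d :=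
  AddSubgroup.subset_closure ⟨a, i, h, rfl⟩

lemma lowerTerms_mono {d e : ℕ} (h : d ≤ e) : lowerTerms C X d ≤ lowerTerms C X e := by
  refine AddSubgroup.closure_mono ?_
  rintro _ ⟨a, i, hi, rfl⟩
  exact ⟨a, i, hi.trans_le h, rfl⟩

lemma C_mul_mem_lowerTerms (b : L) {d : ℕ} {r : R} (hr : r ∈ lowerTerms C X d) :
    C b * r ∈ lowerTerms C X d := by
  induction hr using AddSubgroup.closure_induction with
  | mem r hr =>
    obtain ⟨a, i, hi, rfl⟩ := hr
    rw [← mul_assoc, ← map_mul]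
    exact monomial_mem_lowerTerms _ hi
  | zero => simp
  | add r s _ _ h₁ h₂ => rw [mul_add]; exact add_mem h₁ h₂
  | neg r _ h => rw [mul_neg]; exact neg_mem h

lemma mul_X_pow_mem_lowerTerms (j : ℕ) {d : ℕ} {r : R} (hr : r ∈ lowerTerms C X d) :
    r * X ^ j ∈ lowerTerms C X (d + j) := by
  induction hr using AddSubgroup.closure_induction with
  | mem r hr =>
    obtain ⟨a, i, hi, rfl⟩ := hr
    rw [mul_assoc, ← pow_add]
    exact monomial_mem_lowerTerms _ (by omega)
  | zero => simp
  | add r s _ _ h₁ h₂ => rw [add_mul]; exact add_mem h₁ h₂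
  | neg r _ h => rw [neg_mul]; exact neg_mem h

lemma exists_finsupp_of_mem_lowerTerms {d : ℕ} {r : R} (hr : r ∈ lowerTerms C X d) :
    ∃ f : ℕ →₀ L, (∀ i, d ≤ i → f i = 0) ∧ r = f.sum fun n a => C a * X ^ n := by
  induction hr using AddSubgroup.closure_induction with
  | mem r hr =>
    obtain ⟨a, i, hi, rfl⟩ := hr
    refine ⟨Finsupp.single i a, fun j hj => Finsupp.single_eq_of_ne (by omega), ?_⟩
    rw [Finsupp.sum_single_index (by simp)]
  | zero => exact ⟨0, by simp, by simp⟩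
  | add r s _ _ h₁ h₂ =>
    obtain ⟨f, hf, rfl⟩ := h₁
    obtain ⟨f', hf', rfl⟩ := h₂
    refine ⟨f + f', fun i hi => by simp [hf i hi, hf' i hi], ?_⟩
    rw [Finsupp.sum_add_index' (by simp) (by simp [add_mul])]
  | neg r _ h =>
    obtain ⟨f, hf, rfl⟩ := h
    refine ⟨-f, fun i hi => by simp [hf i hi], ?_⟩
    rw [Finsupp.sum_neg_index (by simp), Finsupp.sum, Finsupp.sum, ← Finset.sum_neg_distrib]
    simp

end LowerTerms

section Degree

variable {L : Type*} [Field L] {σ : L ≃+* L} {δ : L → L} {R : Type*} [Ring R] {C : L →+* R}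
  {X : R}

lemma X_mul_mem_lowerTerms (H : IsOreExtension σ δ R C X) {d : ℕ} {r : R}
    (hr : r ∈ lowerTerms C X d) : X * r ∈ lowerTerms C X (d + 1) := by
  induction hr using AddSubgroup.closure_induction with
  | mem r hr =>
    obtain ⟨a, i, hi, rfl⟩ := hr
    rw [← mul_assoc, H.twist, add_mul, mul_assoc, ← pow_succ']
    exact add_mem (monomial_mem_lowerTerms _ (by omega)) (monomial_mem_lowerTerms _ (by omega))
  | zero => simp
  | add r s _ _ h₁ h₂ => rw [mul_add]; exact add_mem h₁ h₂
  | neg r _ h => rw [mul_neg]; exact neg_mem h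

lemma X_pow_mul_mem_lowerTerms (H : IsOreExtension σ δ R C X) (i : ℕ) {d : ℕ} {r : R}
    (hr : r ∈ lowerTerms C X d) : X ^ i * r ∈ lowerTerms C X (d + i) := by
  induction i with
  | zero => simpa using hr
  | succ i ih =>
    rw [pow_succ', mul_assoc]
    exact H.X_mul_mem_lowerTerms ih

lemma X_pow_mul_C (H : IsOreExtension σ δ R C X) (i : ℕ) (a : L) :
    X ^ i * C a - C (σ^[i] a) * X ^ i ∈ lowerTerms C X i := by
  induction i with
  | zero => simp
  | succ i ih =>
    have key : X ^ (i + 1) * C a - C (σ^[i + 1] a) * X ^ (i + 1) =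
        X * (X ^ i * C a - C (σ^[i] a) * X ^ i) + C (δ (σ^[i] a)) * X ^ i := by
      rw [mul_sub, ← mul_assoc X (C _), H.twist, Function.iterate_succ_apply', pow_succ']
      noncomm_ring
    rw [key]
    exact add_mem (H.X_mul_mem_lowerTerms ih) (monomial_mem_lowerTerms _ (by omega))

lemma mul_mem_lowerTerms (H : IsOreExtension σ δ R C X) {d e : ℕ} {r q : R}
    (hr : r ∈ lowerTerms C X d) (hq : q ∈ lowerTerms C X (e + 1)) :
    r * q ∈ lowerTerms C X (d + e) := by
  induction hr using AddSubgroup.closure_induction with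
  | mem r hr =>
    obtain ⟨a, i, hi, rfl⟩ := hr
    rw [mul_assoc]
    exact C_mul_mem_lowerTerms _
      (lowerTerms_mono (by omega) (H.X_pow_mul_mem_lowerTerms i hq))
  | zero => simp
  | add r s _ _ h₁ h₂ => rw [add_mul]; exact add_mem h₁ h₂
  | neg r _ h => rw [neg_mul]; exact neg_mem h

lemma eq_zero_of_monomial_mem_lowerTerms (H : IsOreExtension σ δ R C X) {a : L} {d : ℕ}
    (h : C a * X ^ d ∈ lowerTerms C X d) : a = 0 := by
  obtain ⟨f, hf, hsum⟩ := exists_finsupp_of_mem_lowerTerms h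
  have heq : Finsupp.single d a = f :=
    (H.repr_unique (C a * X ^ d)).unique (by rw [Finsupp.sum_single_index (by simp)]) hsum
  have := hf d le_rfl
  rwa [← heq, Finsupp.single_eq_same] at this

lemma deg_eq_bot (H : IsOreExtension σ δ R C X) {r : R} : H.deg r = ⊥ ↔ r = 0 := by
  have hspec := (H.repr_unique r).exists.choose_spec
  rw [deg, Finset.max_eq_bot, Finsupp.support_eq_empty]
  constructor
  · intro h
    rw [hspec, h, Finsupp.sum_zero_index]
  · rintro rfl
    exact (H.repr_unique 0).unique hspec (by simp)

lemma exists_deg_eq_coe (H : IsOreExtension σ δ R C X) {r : R} (hr : r ≠ 0) :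
    ∃ d : ℕ, H.deg r = d := by
  obtain ⟨d, hd⟩ := WithBot.ne_bot_iff_exists.1 (mt H.deg_eq_bot.1 hr)
  exact ⟨d, hd.symm⟩

lemma exists_leading_of_deg_eq (H : IsOreExtension σ δ R C X) {r : R} {d : ℕ}
    (h : H.deg r = d) : ∃ a ≠ 0, r - C a * X ^ d ∈ lowerTerms C X d := by
  have hspec := (H.repr_unique r).exists.choose_spec
  rw [deg] at h
  generalize (H.repr_unique r).exists.choose = f at h hspec
  have hd : d ∈ f.support := Finset.mem_of_max h
  refine ⟨f d, Finsupp.mem_support_iff.1 hd, ?_⟩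
  rw [hspec, Finsupp.sum, ← Finset.add_sum_erase _ _ hd, add_sub_cancel_left]
  refine sum_mem fun i hi => monomial_mem_lowerTerms _ ?_
  exact lt_of_le_of_ne (Finset.le_max_of_eq (Finset.mem_of_mem_erase hi) h)
    (Finset.ne_of_mem_erase hi)

lemma deg_eq_of_leading (H : IsOreExtension σ δ R C X) {r : R} {d : ℕ} {a : L} (ha : a ≠ 0)
    (h : r - C a * X ^ d ∈ lowerTerms C X d) : H.deg r = d := by
  have hr : r ≠ 0 := by
    rintro rfl
    exact ha (H.eq_zero_of_monomial_mem_lowerTerms (by simpa using h))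
  obtain ⟨e, he⟩ := H.exists_deg_eq_coe hr
  obtain ⟨b, hb, hb'⟩ := H.exists_leading_of_deg_eq he
  rw [he]
  obtain hlt | rfl | hlt := lt_trichotomy d e
  · refine absurd (H.eq_zero_of_monomial_mem_lowerTerms (d := e) ?_) hb
    have := sub_mem (add_mem (lowerTerms_mono hlt.le h) (monomial_mem_lowerTerms a hlt)) hb'
    simpa using this
  · rfl
  · refine absurd (H.eq_zero_of_monomial_mem_lowerTerms (d := d) ?_) ha
    have := sub_mem (add_mem (lowerTerms_mono hlt.le hb') (monomial_mem_lowerTerms b hlt)) h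
    simpa using this

lemma deg_mul (H : IsOreExtension σ δ R C X) (p q : R) :
    H.deg (p * q) = H.deg p + H.deg q := by
  by_cases hp : p = 0
  · simp [hp, H.deg_eq_bot.2]
  by_cases hq : q = 0
  · simp [hq, H.deg_eq_bot.2]
  obtain ⟨i, hi⟩ := H.exists_deg_eq_coe hp
  obtain ⟨j, hj⟩ := H.exists_deg_eq_coe hq
  obtain ⟨a, ha, ha'⟩ := H.exists_leading_of_deg_eq hi
  obtain ⟨b, hb, hb'⟩ := H.exists_leading_of_deg_eq hj
  have hq' : q ∈ lowerTerms C X (j + 1) := by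
    simpa using add_mem (lowerTerms_mono j.le_succ hb') (monomial_mem_lowerTerms b j.lt_succ_self)
  have hσ : σ^[i] b ≠ 0 := fun h0 =>
    hb ((σ.injective.iterate i) (h0.trans (iterate_map_zero σ i).symm))
  rw [hi, hj, ← Nat.cast_add]
  refine H.deg_eq_of_leading (mul_ne_zero ha hσ) ?_
  have key : p * q - C (a * σ^[i] b) * X ^ (i + j) =
      (p - C a * X ^ i) * q + C a * (X ^ i * (q - C b * X ^ j)) +
        C a * ((X ^ i * C b - C (σ^[i] b) * X ^ i) * X ^ j) := by
    rw [map_mul, pow_add]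
    noncomm_ring
  rw [key]
  refine add_mem (add_mem (H.mul_mem_lowerTerms ha' hq') (C_mul_mem_lowerTerms _ ?_))
    (C_mul_mem_lowerTerms _ (mul_X_pow_mem_lowerTerms j (H.X_pow_mul_C i b)))
  rw [add_comm i j]
  exact H.X_pow_mul_mem_lowerTerms i hb'

lemma noZeroDivisors (H : IsOreExtension σ δ R C X) : NoZeroDivisors R where
  eq_zero_or_eq_zero_of_mul_eq_zero {a b} h := by
    rw [← H.deg_eq_bot, deg_mul, WithBot.add_eq_bot] at h
    simpa [H.deg_eq_bot] using h

lemma deg_C (H : IsOreExtension σ δ R C X) {a : L} (ha : a ≠ 0) : H.deg (C a) = 0 :=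
  H.deg_eq_of_leading (d := 0) ha (by simp)

lemma deg_X_sub_C (H : IsOreExtension σ δ R C X) (a : L) : H.deg (X - C a) = 1 := by
  refine H.deg_eq_of_leading (d := 1) one_ne_zero ?_
  simpa using neg_mem (monomial_mem_lowerTerms (C := C) (X := X) a zero_lt_one)

lemma exists_eq_C_of_deg_eq_zero (H : IsOreExtension σ δ R C X) {r : R} (h : H.deg r = 0) :
    ∃ a ≠ 0, r = C a := by
  obtain ⟨a, ha, hr⟩ := H.exists_leading_of_deg_eq (d := 0) h
  refine ⟨a, ha, ?_⟩
  simpa [lowerTerms, sub_eq_zero] using hr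

lemma zero_le_deg (H : IsOreExtension σ δ R C X) {r : R} (hr : r ≠ 0) : 0 ≤ H.deg r := by
  obtain ⟨i, hi⟩ := H.exists_deg_eq_coe hr
  rw [hi]
  exact_mod_cast i.zero_le

lemma deg_le_of_rDvd (H : IsOreExtension σ δ R C X) {p q : R} (hq : q ≠ 0) (h : RDvd p q) :
    H.deg p ≤ H.deg q := by
  obtain ⟨t, rfl⟩ := h
  rw [deg_mul]
  exact le_add_of_nonneg_left (H.zero_le_deg (left_ne_zero_of_mul hq))

lemma eq_zero_of_X_sub_C_rDvd_C (H : IsOreExtension σ δ R C X) {a b : L}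
    (h : RDvd (X - C a) (C b)) : b = 0 := by
  by_contra hb
  have hle := H.deg_le_of_rDvd (mt H.deg_eq_bot.2 (by simp [H.deg_C hb])) h
  rw [deg_X_sub_C, deg_C H hb] at hle
  exact absurd hle (by decide)

lemma exists_eq_mul_X_sub_C_add_C (H : IsOreExtension σ δ R C X) (a : L) (r : R) :
    ∃ q b, r = q * (X - C a) + C b := by
  have hpow (i : ℕ) : ∃ q b, X ^ i = q * (X - C a) + C b := by
    induction i with
    | zero => exact ⟨0, 1, by simp⟩
    | succ i ih =>
      obtain ⟨q, b, h⟩ := ih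
      refine ⟨X * q + C (σ b), σ b * a + δ b, ?_⟩
      rw [pow_succ', h, mul_add, H.twist, map_add, map_mul]
      noncomm_ring
  obtain ⟨f, rfl, -⟩ := H.repr_unique r
  refine Finset.sum_induction _ (fun r => ∃ q b, r = q * (X - C a) + C b) ?_
    ⟨0, 0, by simp⟩ ?_
  · rintro _ _ ⟨q, b, rfl⟩ ⟨q', b', rfl⟩
    exact ⟨q + q', b + b', by rw [map_add, add_mul]; abel⟩
  · intro i _
    obtain ⟨q, b, h⟩ := hpow i
    exact ⟨C (f i) * q, f i * b, by simp only [h, map_mul, mul_add, mul_assoc]⟩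

end Degree

section Lclm

variable {L : Type*} [Field L] {σ : L ≃+* L} {δ : L → L} {R : Type*} [Ring R] {C : L →+* R}
  {X : R}

lemma exists_lclm_X_sub_C (H : IsOreExtension σ δ R C X) {p : R} (hp : p ≠ 0) (a : L) :
    ∃ q ≠ 0, RDvd p q ∧ RDvd (X - C a) q ∧
      (∀ m, RDvd p m → RDvd (X - C a) m → RDvd q m) ∧ H.deg q ≤ H.deg p + 1 := by
  have := H.noZeroDivisors
  obtain ⟨q, b, hq⟩ := H.exists_eq_mul_X_sub_C_add_C a p
  by_cases hb : b = 0
  · refine ⟨p, hp, ⟨1, by simp⟩, ⟨q, by simpa [hb] using hq⟩, fun m hm _ => hm, ?_⟩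
    exact le_add_of_nonneg_right zero_le_one
  obtain ⟨β, hβ⟩ : ∃ β : L, (X - C β) * C b = C (σ b) * (X - C a) := by
    refine ⟨(δ b + σ b * a) / b, ?_⟩
    rw [sub_mul, ← map_mul, div_mul_cancel₀ _ hb, H.twist, map_add, map_mul]
    noncomm_ring
  refine ⟨(X - C β) * p, mul_ne_zero ?_ hp, ⟨_, rfl⟩, ⟨(X - C β) * q + C (σ b), ?_⟩, ?_, ?_⟩
  · exact mt H.deg_eq_bot.2 (by simp [H.deg_X_sub_C])
  · rw [hq, mul_add, hβ, add_mul, mul_assoc]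
  · rintro _ ⟨t, rfl⟩ ⟨w, hw⟩
    obtain ⟨t', c, rfl⟩ := H.exists_eq_mul_X_sub_C_add_C β t
    have hcb : RDvd (X - C a) (C (c * b)) := by
      refine ⟨w - (t' * (X - C β) + C c) * q - t' * C (σ b), ?_⟩
      have h₁ : (t' * (X - C β) + C c) * p = (t' * (X - C β) + C c) * q * (X - C a) +
          t' * C (σ b) * (X - C a) + C (c * b) := by
        nth_rw 1 [hq]
        rw [mul_add, add_mul _ _ (C b), mul_assoc t' (X - C β), hβ, map_mul]
        noncomm_ring
      rw [sub_mul, sub_mul, ← hw, h₁]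
      abel
    have hc : c = 0 := (mul_eq_zero.1 (H.eq_zero_of_X_sub_C_rDvd_C hcb)).resolve_right hb
    exact ⟨t', by simp [hc, mul_assoc]⟩
  · rw [deg_mul, deg_X_sub_C, add_comm]

lemma exists_lclm_finset (H : IsOreExtension σ δ R C X) {ι : Type*} (α : ι → L) {p : R}
    (hp : p ≠ 0) (S : Finset ι) :
    ∃ q ≠ 0, RDvd p q ∧ (∀ i ∈ S, RDvd (X - C (α i)) q) ∧
      (∀ m, RDvd p m → (∀ i ∈ S, RDvd (X - C (α i)) m) → RDvd q m) ∧
      H.deg q ≤ H.deg p + S.card := by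
  classical
  induction S using Finset.induction_on with
  | empty => exact ⟨p, hp, ⟨1, by simp⟩, by simp, fun m hm _ => hm, by simp⟩
  | insert i S hi ih =>
    obtain ⟨q, hq, hpq, hSq, hmin, hdeg⟩ := ih
    obtain ⟨q', hq', ⟨t, rfl⟩, hiq', hmin', hdeg'⟩ := H.exists_lclm_X_sub_C hq (α i)
    have trans {f : R} (hf : RDvd f q) : RDvd f (t * q) := by
      obtain ⟨w, rfl⟩ := hf
      exact ⟨t * w, by rw [mul_assoc]⟩
    refine ⟨t * q, hq', trans hpq, ?_, ?_, ?_⟩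
    · intro j hj
      obtain rfl | hj := Finset.mem_insert.1 hj
      exacts [hiq', trans (hSq j hj)]
    · intro m hpm hm
      exact hmin' m (hmin m hpm fun j hj => hm j (Finset.mem_insert_of_mem hj))
        (hm i (Finset.mem_insert_self _ _))
    · rw [Finset.card_insert_of_notMem hi, Nat.cast_add, ← add_assoc, Nat.cast_one]
      exact hdeg'.trans (by gcongr)

lemma card_le_deg (H : IsOreExtension σ δ R C X) {n : ℕ} {α : Fin n → L} {Λ : R}
    (hΛ : IsLclm (fun i : Fin n => X - C (α i)) Λ) (hdeg : H.deg Λ = n) {p : R} (hp : p ≠ 0)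
    {S : Finset (Fin n)} (hS : ∀ i ∈ S, RDvd (X - C (α i)) p) :
    (S.card : WithBot ℕ) ≤ H.deg p := by
  obtain ⟨q, hq, ⟨t, rfl⟩, hSq, -, hdq⟩ := H.exists_lclm_finset α hp Sᶜ
  have hle := H.deg_le_of_rDvd hq (hΛ.2 (t * p) fun i => by
    by_cases hi : i ∈ S
    · obtain ⟨w, hw⟩ := hS i hi
      exact ⟨t * w, by rw [hw, mul_assoc]⟩
    · exact hSq i (Finset.mem_compl.2 hi))
  obtain ⟨d, hd⟩ := H.exists_deg_eq_coe hp
  have hcard := S.card_add_card_compl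
  rw [Fintype.card_fin] at hcard
  rw [hdeg] at hle
  replace hle := hle.trans hdq
  rw [hd] at hle ⊢
  norm_cast at hle ⊢
  omega

lemma exists_common_multiple_finset (H : IsOreExtension σ δ R C X) [Nontrivial R] {ι : Type*}
    (α : ι → L) (S : Finset ι) :
    ∃ q ≠ 0, (∀ i ∈ S, RDvd (X - C (α i)) q) ∧
      (∀ m, (∀ i ∈ S, RDvd (X - C (α i)) m) → RDvd q m) ∧ H.deg q ≤ S.card := by
  obtain ⟨q, hq, -, hS, hmin, hdeg⟩ := H.exists_lclm_finset α one_ne_zero S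
  have h1 : H.deg 1 = 0 := by simpa using H.deg_C one_ne_zero
  exact ⟨q, hq, hS, fun m hm => hmin m ⟨m, by simp⟩ hm, by simpa [h1] using hdeg⟩

/-- A polynomial with as many positional right roots as its degree is a least common left
multiple of the corresponding linear factors. -/
lemma rDvd_of_deg_le_card (H : IsOreExtension σ δ R C X) {n : ℕ} {α : Fin n → L} {Λ : R}
    (hΛ : IsLclm (fun i : Fin n => X - C (α i)) Λ) (hdeg : H.deg Λ = n) {v m : R} (hv : v ≠ 0)
    {S : Finset (Fin n)} (hS : ∀ i ∈ S, RDvd (X - C (α i)) v) (hvS : H.deg v ≤ S.card)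
    (hm : ∀ i ∈ S, RDvd (X - C (α i)) m) : RDvd v m := by
  have : Nontrivial R := ⟨v, 0, hv⟩
  obtain ⟨q, hq, hSq, hmin, -⟩ := H.exists_common_multiple_finset α S
  obtain ⟨a, rfl⟩ := hmin v hS
  obtain ⟨b, rfl⟩ := hmin m hm
  obtain ⟨i, hi⟩ := H.exists_deg_eq_coe (left_ne_zero_of_mul hv)
  obtain ⟨j, hj⟩ := H.exists_deg_eq_coe hq
  have hle := hvS.trans (H.card_le_deg hΛ hdeg hq hSq)
  rw [deg_mul, hi, hj] at hle
  have hi0 : i = 0 := by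
    norm_cast at hle
    omega
  obtain ⟨c, hc, rfl⟩ := H.exists_eq_C_of_deg_eq_zero (by simpa [hi0] using hi)
  refine ⟨b * C c⁻¹, ?_⟩
  rw [mul_assoc, ← mul_assoc (C _), ← map_mul, inv_mul_cancel₀ hc, map_one, one_mul]

/-- If the error locator and the error evaluator share a left factor `h`, then a cofactor `v` of
the locator which is a least common left multiple of positional linear factors must be divisible
by all the linear factors at error positions. -/
lemma rDvd_cofactor_of_common_left_factor (H : IsOreExtension σ δ R C X) {n : ℕ}
    {α : Fin n → L} {Λ : R} (hΛ : IsLclm (fun i : Fin n => X - C (α i)) Λ) (hdeg : H.deg Λ = n)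
    {ν : ℕ} {k : Fin ν → Fin n} (hk : Function.Injective k) {d : Fin ν → L}
    (hd : ∀ j, d j ≠ 0) {lam : R} (hlam0 : lam ≠ 0)
    (hlam : IsLclm (fun j => X - C (α (k j))) lam) {ρ : Fin ν → R}
    (hρ : ∀ j, lam = ρ j * (X - C (α (k j)))) {h v r : R} (hhv : h * v = lam)
    (hhr : h * r = ∑ j, ρ j * C (d j))
    {S : Finset (Fin n)} (hSk : ∀ i ∈ S, ∃ j, k j = i) (hS : ∀ i ∈ S, RDvd (X - C (α i)) v)
    (hvS : H.deg v ≤ S.card) (j : Fin ν) : RDvd (X - C (α (k j))) v := by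
  classical
  have := H.noZeroDivisors
  have : Nontrivial R := ⟨lam, 0, hlam0⟩
  have hX (a : L) : X - C a ≠ 0 := mt H.deg_eq_bot.2 (by simp [H.deg_X_sub_C])
  by_contra hj
  have hv : v ≠ 0 := by
    rintro rfl
    exact hlam0 (by simpa using hhv.symm)
  let K : Finset (Fin n) := (Finset.univ.erase j).image k
  obtain ⟨w, hw, hKw, hmin, hdegw⟩ := H.exists_common_multiple_finset α K
  have hkK {i : Fin ν} (hi : i ≠ j) : k i ∈ K :=
    Finset.mem_image_of_mem _ (Finset.mem_erase.2 ⟨hi, Finset.mem_univ _⟩)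
  obtain ⟨f, hf⟩ := hmin lam fun i hi => by
    obtain ⟨l, -, rfl⟩ := Finset.mem_image.1 hi
    exact hlam.1 l
  have hf0 : f ≠ 0 := by
    rintro rfl
    exact hlam0 (by simpa using hf)
  obtain ⟨t, ht⟩ := H.rDvd_of_deg_le_card hΛ hdeg hv hS hvS (m := w) fun i hi => by
    obtain ⟨l, rfl⟩ := hSk i hi
    exact hKw _ (hkK (by rintro rfl; exact hj (hS _ hi)))
  have hh : h = f * t := mul_right_cancel₀ hv (by rw [hhv, hf, ht, mul_assoc])
  have hρf {i : Fin ν} (hi : i ≠ j) : ∃ q, ρ i = f * q := by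
    obtain ⟨q, hq⟩ := hKw _ (hkK hi)
    exact ⟨q, mul_right_cancel₀ (hX (α (k i))) (by rw [← hρ, hf, hq, mul_assoc])⟩
  obtain ⟨q, hq⟩ : ∃ q, ρ j = f * q := by
    have hsum : ∃ q, ∑ i ∈ Finset.univ.erase j, ρ i * C (d i) = f * q := by
      refine Finset.sum_induction _ (fun r => ∃ q, r = f * q) ?_ ⟨0, by simp⟩ ?_
      · rintro _ _ ⟨q, rfl⟩ ⟨q', rfl⟩
        exact ⟨q + q', by rw [mul_add]⟩
      · intro i hi
        obtain ⟨q, hq⟩ := hρf (Finset.ne_of_mem_erase hi)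
        exact ⟨q * C (d i), by rw [hq, mul_assoc]⟩
    obtain ⟨q, hq⟩ := hsum
    rw [← Finset.add_sum_erase _ _ (Finset.mem_univ j), hq, hh, mul_assoc, ← sub_eq_iff_eq_add,
      ← mul_sub] at hhr
    refine ⟨(t * r - q) * C (d j)⁻¹, ?_⟩
    rw [← mul_assoc, hhr, mul_assoc, ← map_mul, mul_inv_cancel₀ (hd j), map_one, mul_one]
  have hwj : RDvd (X - C (α (k j))) w :=
    ⟨q, mul_left_cancel₀ hf0 (by rw [← hf, hρ j, hq, mul_assoc])⟩
  have hjK : k j ∉ K := by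
    simp [K, hk.eq_iff]
  have hcard := (H.card_le_deg hΛ hdeg hw (S := insert (k j) K) fun i hi => by
    obtain rfl | hi := Finset.mem_insert.1 hi
    exacts [hwj, hKw i hi]).trans hdegw
  rw [Finset.card_insert_of_notMem hjK] at hcard
  norm_cast at hcard
  omega

end Lclm

end IsOreExtension

/-- Proposition 11 of the paper (criterion for decoding success): with
`u * g + v * s = r`, `h * u = κ`, `h * v = lam`, `h * r = ω`, the number `m` of
positional points that are right roots of `v` equals `deg v` if and only if
`deg h = 0`. -/
theorem criterion_decoding_success
    {L : Type*} [Field L] (σ : L ≃+* L) (δ : L → L) (hδ : IsSigmaDerivation σ δ)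
    {R : Type*} [Ring R] (C : L →+* R) (X : R) (H : IsOreExtension σ δ R C X)
    (F : Subfield L) (n : ℕ) (α : Fin n → L) (hα : Function.Injective α)
    (g : R) (hg0 : g ≠ 0)
    (hginv : ∀ a : R, ∃ b : R, a * g = g * b) (hginv' : ∀ a : R, ∃ b : R, g * a = b * g)
    (hcop : ∀ i, RCoprime (X - C (α i)) g)
    (hp : Fin n → R) (hpdeg : ∀ i, H.deg (hp i) < H.deg g)
    (hpinv : ∀ i, ∃ w : R, (X - C (α i)) * hp i - 1 = w * g)
    (η : Fin n → L) (hη : ∀ i, η i ≠ 0)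
    (c e y : Fin n → L) (hcF : ∀ i, c i ∈ F) (heF : ∀ i, e i ∈ F)
    (hcode : ∑ i, hp i * C (η i) * C (c i) = 0)
    (ν : ℕ) (k : Fin ν → Fin n) (hk : Function.Injective k)
    (hek : ∀ j, e (k j) ≠ 0) (hesupp : ∀ i, (∀ j, k j ≠ i) → e i = 0)
    (hy : y = c + e)
    (s : R) (hs : s = ∑ i, hp i * C (η i) * C (y i))
    (lam : R) (hlam : IsLclm (fun j : Fin ν => X - C (α (k j))) lam)
    (ρ : Fin ν → R) (hρ : ∀ j, lam = ρ j * (X - C (α (k j))))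
    (ω : R) (hω : ω = ∑ j, ρ j * C (η (k j)) * C (e (k j)))
    (χ : ℕ) (hχ : H.deg g = (χ : WithBot ℕ)) (hν : ν ≤ χ / 2)
    (Pind : ∃ Λ : R, IsLclm (fun i : Fin n => X - C (α i)) Λ ∧ H.deg Λ = (n : WithBot ℕ))
    (κ : R) (hκ : ω = κ * g + lam * s)
    (u v r h : R) (huvr : u * g + v * s = r)
    (hhu : h * u = κ) (hhv : h * v = lam) (hhr : h * r = ω) :
    (({l : Fin n | RDvd (X - C (α l)) v}.ncard : WithBot ℕ) = H.deg v) ↔ H.deg h = 0 := by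
  classical
  obtain ⟨Λ, hΛ, hΛdeg⟩ := Pind
  have := H.noZeroDivisors
  have : Nontrivial R := ⟨g, 0, hg0⟩
  have hKcard : (Finset.univ.image k).card = ν := by
    rw [Finset.card_image_of_injective _ hk, Finset.card_univ, Fintype.card_fin]
  obtain ⟨p, hp0, hKp, -, hpK⟩ := H.exists_common_multiple_finset α (Finset.univ.image k)
  rw [hKcard] at hpK
  have hlamp : RDvd lam p :=
    hlam.2 p fun j => hKp _ (Finset.mem_image_of_mem _ (Finset.mem_univ j))
  have hlam0 : lam ≠ 0 := by
    rintro rfl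
    obtain ⟨w, rfl⟩ := hlamp
    simp at hp0
  have hlamdeg : H.deg lam ≤ ν := (H.deg_le_of_rDvd hp0 hlamp).trans hpK
  have hh0 : h ≠ 0 := left_ne_zero_of_mul (hhv.trans_ne hlam0)
  have hv0 : v ≠ 0 := right_ne_zero_of_mul (hhv.trans_ne hlam0)
  obtain ⟨a, ha⟩ := H.exists_deg_eq_coe hh0
  obtain ⟨b, hb⟩ := H.exists_deg_eq_coe hv0
  have hab : a + b ≤ ν := by
    rw [← hhv, H.deg_mul, ha, hb] at hlamdeg
    exact_mod_cast hlamdeg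
  set T : Finset (Fin n) := Finset.univ.filter fun l => RDvd (X - C (α l)) v with hT
  have hTv : ∀ l ∈ T, RDvd (X - C (α l)) v := fun l hl => (Finset.mem_filter.1 hl).2
  have hncard : {l : Fin n | RDvd (X - C (α l)) v}.ncard = T.card := by
    rw [← Set.ncard_coe_finset, hT, Finset.coe_filter_univ]
  have hcard_le (hK : ∀ j, RDvd (X - C (α (k j))) v) : ν ≤ T.card := by
    rw [← hKcard]
    refine Finset.card_le_card fun i hi => ?_
    obtain ⟨j, -, rfl⟩ := Finset.mem_image.1 hi
    exact Finset.mem_filter.2 ⟨Finset.mem_univ _, hK j⟩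
  have hTb : T.card ≤ b := by
    have := H.card_le_deg hΛ hΛdeg hv0 hTv
    rw [hb] at this
    exact_mod_cast this
  rw [hncard, ha, hb]
  constructor
  · intro hm
    have hTk : ∀ i ∈ T, ∃ j, k j = i := by
      intro i hi
      by_contra hik
      have hik' : i ∉ Finset.univ.image k := by simpa using hik
      have hle := (H.card_le_deg hΛ hΛdeg hlam0 (S := insert i (Finset.univ.image k))
        fun l hl => by
          obtain rfl | hl := Finset.mem_insert.1 hl
          · obtain ⟨w, hw⟩ := hTv l hi
            exact ⟨h * w, by rw [← hhv, hw, mul_assoc]⟩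
          · obtain ⟨j, -, rfl⟩ := Finset.mem_image.1 hl
            exact hlam.1 j).trans hlamdeg
      rw [Finset.card_insert_of_notMem hik', hKcard] at hle
      norm_cast at hle
      omega
    have hνT := hcard_le (H.rDvd_cofactor_of_common_left_factor hΛ hΛdeg hk
      (r := r) (d := fun j => η (k j) * e (k j)) (fun j => mul_ne_zero (hη _) (hek j)) hlam0 hlam hρ hhv
      (by simp only [hhr, hω, map_mul, mul_assoc]) hTk hTv (hb.trans hm.symm).le)
    norm_cast
    omega
  · intro h0
    obtain ⟨c, hc, rfl⟩ := H.exists_eq_C_of_deg_eq_zero (ha.trans h0)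
    have hvl : v = C c⁻¹ * lam := by
      rw [← hhv, ← mul_assoc, ← map_mul, inv_mul_cancel₀ hc, map_one, one_mul]
    have hνT := hcard_le fun j => ⟨C c⁻¹ * ρ j, by rw [mul_assoc, ← hρ, hvl]⟩
    norm_cast
    omega
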